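/- arXiv:1002.1594 — 10 statements merged into one kernel-verified Lean document; each statement's English description precedes it below -/
import Mathlib

section
/- Let K be a field of characteristic zero and let a, b ∈ K. Define a bilinear bracket on the polynomial ring K[x,h,y] by {f,g}_{a,b} = (a + b·h) · ( h·(∂_x f · ∂_y g − ∂_y f · ∂_x g) + 2x·(∂_h f · ∂_x g − ∂_x f · ∂_h g) − 2y·(∂_h f · ∂_y g − ∂_y f · ∂_h g) ). Then for all polynomials f, g, k ∈ K[x,h,y] the Jacobi identity holds: {f,{g,k}_{a,b}}_{a,b} + {g,{k,f}_{a,b}}_{a,b} + {k,{f,g}_{a,b}}_{a,b} = 0. In particular, the linear Poisson–Lie bracket of sl(2) (the case a=1, b=0, which satisfies {x,y}=h, {h,x}=2x, {h,y}=−2y), the quadratic bracket {,}' (the case a=0, b=1, which satisfies {x,y}'=h², {h,x}'=2xh, {h,y}'=−2yh), and every linear combination of them are Poisson brackets, so the two brackets are compatible. -/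
open MvPolynomial

/-- The pencil of Poisson brackets on `K[x,h,y]` (variables `X 0 = x`, `X 1 = h`, `X 2 = y`):
`{f,g}_{a,b} = (a + b·h) · ( h·(∂ₓf ∂_y g − ∂_y f ∂ₓg) + 2x·(∂_h f ∂ₓg − ∂ₓf ∂_h g)
  − 2y·(∂_h f ∂_y g − ∂_y f ∂_h g) )`. -/
noncomputable def slPencilBracket {K : Type*} [Field K] (a b : K)
    (f g : MvPolynomial (Fin 3) K) : MvPolynomial (Fin 3) K :=
  (C a + C b * X 1) *
    (X 1 * (pderiv 0 f * pderiv 2 g - pderiv 2 f * pderiv 0 g)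
      + 2 * X 0 * (pderiv 1 f * pderiv 0 g - pderiv 0 f * pderiv 1 g)
      - 2 * X 2 * (pderiv 1 f * pderiv 2 g - pderiv 2 f * pderiv 1 g))

/-- Formal partial derivatives commute. -/
theorem MvPolynomial.pderiv_pderiv_comm {R σ : Type*} [CommRing R] (i j : σ)
    (p : MvPolynomial σ R) : pderiv i (pderiv j p) = pderiv j (pderiv i p) := by
  have h : ⁅pderiv (R := R) i, pderiv (R := R) j⁆ = 0 := by
    classical
    refine MvPolynomial.derivation_ext fun k => ?_
    simp [Derivation.commutator_apply, pderiv_X, Pi.single_apply, apply_ite]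
  simpa [Derivation.commutator_apply, sub_eq_zero] using congrArg (fun D => D p) h

/-- The Jacobi identity holds for every bracket `{,}_{a,b}` of the pencil spanned by the
`sl(2)` Poisson–Lie bracket (`a=1, b=0`) and the quadratic bracket `{,}'` (`a=0, b=1`);
in particular both brackets and all their linear combinations are Poisson brackets, i.e.
the two brackets are compatible. -/
theorem slPencil_jacobi {K : Type*} [Field K] [CharZero K] (a b : K)
    (f g k : MvPolynomial (Fin 3) K) :
    slPencilBracket a b f (slPencilBracket a b g k)
      + slPencilBracket a b g (slPencilBracket a b k f)
      + slPencilBracket a b k (slPencilBracket a b f g) = 0 := by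
  have two (i : Fin 3) : pderiv i (2 : MvPolynomial (Fin 3) K) = 0 := by
    simpa using (pderiv i).map_natCast 2
  simp only [slPencilBracket, Derivation.leibniz, map_add, map_sub, smul_eq_mul, two, pderiv_C,
    mul_zero, add_zero, zero_add, mul_one,
    pderiv_X_self, pderiv_X_of_ne (show (1 : Fin 3) ≠ 0 by decide),
    pderiv_X_of_ne (show (0 : Fin 3) ≠ 1 by decide),
    pderiv_X_of_ne (show (1 : Fin 3) ≠ 2 by decide),
    pderiv_X_of_ne (show (2 : Fin 3) ≠ 1 by decide),
    pderiv_X_of_ne (show (0 : Fin 3) ≠ 2 by decide),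
    pderiv_X_of_ne (show (2 : Fin 3) ≠ 0 by decide),
    pderiv_pderiv_comm (1 : Fin 3) 0, pderiv_pderiv_comm (2 : Fin 3) 0, pderiv_pderiv_comm (2 : Fin 3) 1]
  ring
end

section
/- Let K be a field, q ∈ K a unit with 2_q := q + q⁻¹ invertible, and ħ ∈ K. Let A be an associative unital K-algebra containing elements x, h, y satisfying the relations q²·hx − xh = 2_q·ħ·x, q²·yh − hy = 2_q·ħ·y, and (q²+1)·(xy − yx) + (q²−1)·h² = 2_q·ħ·h. Then the element Cas_q = q⁻¹·xy + q·yx + (2_q)⁻¹·h² commutes with each of x, h, y (and hence with every element of the subalgebra they generate). -/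
/-- In the two-parameter quantization `𝒜(hbar,q)` of `Sym(sl(2))`, i.e. in any associative
unital `K`-algebra containing elements `x, h, y` subject to the relations
`q²·hx − xh = 2_q·hbar·x`, `q²·yh − hy = 2_q·hbar·y`,
`(q²+1)·(xy − yx) + (q²−1)·h² = 2_q·hbar·h` (with `2_q = q + q⁻¹`),
the quadratic braided Casimir element `Cas_q = q⁻¹·xy + q·yx + (2_q)⁻¹·h²` commutes with
each of the generators `x, h, y`, hence with every element of the subalgebra they generate. -/
theorem casq_commutes {K A : Type*} [Field K] [Ring A] [Algebra K A]
    (q hbar : K) (hq : q ≠ 0) (h2q : q + q⁻¹ ≠ 0) (x h y : A)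
    (r1 : algebraMap K A (q ^ 2) * (h * x) - x * h = algebraMap K A ((q + q⁻¹) * hbar) * x)
    (r2 : algebraMap K A (q ^ 2) * (y * h) - h * y = algebraMap K A ((q + q⁻¹) * hbar) * y)
    (r3 : algebraMap K A (q ^ 2 + 1) * (x * y - y * x)
            + algebraMap K A (q ^ 2 - 1) * h ^ 2 = algebraMap K A ((q + q⁻¹) * hbar) * h) :
    (algebraMap K A q⁻¹ * (x * y) + algebraMap K A q * (y * x)
        + algebraMap K A (q + q⁻¹)⁻¹ * h ^ 2) * x
      = x * (algebraMap K A q⁻¹ * (x * y) + algebraMap K A q * (y * x)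
        + algebraMap K A (q + q⁻¹)⁻¹ * h ^ 2) ∧
    (algebraMap K A q⁻¹ * (x * y) + algebraMap K A q * (y * x)
        + algebraMap K A (q + q⁻¹)⁻¹ * h ^ 2) * h
      = h * (algebraMap K A q⁻¹ * (x * y) + algebraMap K A q * (y * x)
        + algebraMap K A (q + q⁻¹)⁻¹ * h ^ 2) ∧
    (algebraMap K A q⁻¹ * (x * y) + algebraMap K A q * (y * x)
        + algebraMap K A (q + q⁻¹)⁻¹ * h ^ 2) * y
      = y * (algebraMap K A q⁻¹ * (x * y) + algebraMap K A q * (y * x)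
        + algebraMap K A (q + q⁻¹)⁻¹ * h ^ 2) := by
  simp only [← Algebra.smul_def] at r1 r2 r3 ⊢
  -- normal ordering: `y` to the left of `h` to the left of `x`
  have hxh : x * h = q ^ 2 • (h * x) - ((q + q⁻¹) * hbar) • x := by rw [← r1]; abel
  have hhy : h * y = q ^ 2 • (y * h) - ((q + q⁻¹) * hbar) • y := by rw [← r2]; abel
  have hs : q ^ 2 + 1 = q * (q + q⁻¹) := by field_simp
  have hs0 : q ^ 2 + 1 ≠ 0 := hs ▸ mul_ne_zero hq h2q
  have hxy : x * y = y * x + (q⁻¹ * hbar) • h - ((q ^ 2 - 1) / (q ^ 2 + 1)) • (h * h) := by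
    have e : x * y - y * x = (q ^ 2 + 1)⁻¹ • (((q + q⁻¹) * hbar) • h - (q ^ 2 - 1) • h ^ 2) := by
      rw [← r3, add_sub_cancel_right, smul_smul, inv_mul_cancel₀ hs0, one_smul]
    rw [eq_add_of_sub_eq e, pow_two h]
    match_scalars <;> field_simp
  have hxh' (z : A) : x * (h * z) = q ^ 2 • (h * (x * z)) - ((q + q⁻¹) * hbar) • (x * z) := by
    rw [← mul_assoc, hxh, sub_mul, smul_mul_assoc, smul_mul_assoc, mul_assoc]
  have hhy' (z : A) : h * (y * z) = q ^ 2 • (y * (h * z)) - ((q + q⁻¹) * hbar) • (y * z) := by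
    rw [← mul_assoc, hhy, sub_mul, smul_mul_assoc, smul_mul_assoc, mul_assoc]
  have hxy' (z : A) : x * (y * z) = y * (x * z) + (q⁻¹ * hbar) • (h * z)
      - ((q ^ 2 - 1) / (q ^ 2 + 1)) • (h * (h * z)) := by
    rw [← mul_assoc, hxy, sub_mul, add_mul, smul_mul_assoc, smul_mul_assoc, mul_assoc, mul_assoc]
  refine ⟨?_, ?_, ?_⟩ <;>
    simp only [pow_two h, mul_add, add_mul, mul_sub, sub_mul, smul_mul_assoc, mul_smul_comm,
      mul_assoc, hxh, hhy, hxy, hxh', hhy', hxy'] <;>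
    match_scalars <;> field_simp <;> ring
end

section
/- Let K be a field, q ∈ K a unit, and m, n ≥ 0 with N = m + n ≥ 1. Define the parity p(i) = 0 for 1 ≤ i ≤ m and p(i) = 1 for m+1 ≤ i ≤ N, and define the linear operator R on K^N ⊗ K^N by R(e_i ⊗ e_i) = (−1)^{p(i)} q^{1−2p(i)} e_i ⊗ e_i, and for i ≠ j, R(e_i ⊗ e_j) = (−1)^{p(i)p(j)} e_j ⊗ e_i + (q − q⁻¹)·[i < j]·(e_i ⊗ e_j), where [i<j] is 1 if i<j and 0 otherwise. Then R satisfies the quantum Yang–Baxter (braid) equation on K^N ⊗ K^N ⊗ K^N: (R ⊗ I)(I ⊗ R)(R ⊗ I) = (I ⊗ R)(R ⊗ I)(I ⊗ R). -/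
/-- The standard Hecke symmetry of `GL(m|n)` type on `K^N ⊗ K^N` (`N = m + n`), written as a
matrix in the standard tensor basis `e_i ⊗ e_j` (indexed here from `0`; the parity is `0` on
the first `m` indices and `1` on the last `n`).  Its column with index `(i,j)` records
`R(e_i ⊗ e_j)`:
`R(e_i ⊗ e_i) = (−1)^{p i} q^{1−2·p i} e_i ⊗ e_i` and, for `i ≠ j`,
`R(e_i ⊗ e_j) = (−1)^{p i · p j} e_j ⊗ e_i + (q − q⁻¹)·[i < j]·(e_i ⊗ e_j)`. -/
noncomputable def heckeR (K : Type*) [Field K] (q : K) (m n : ℕ) :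
    Matrix (Fin (m + n) × Fin (m + n)) (Fin (m + n) × Fin (m + n)) K :=
  Matrix.of fun x y =>
    let p : Fin (m + n) → ℕ := fun i => if (i : ℕ) < m then 0 else 1
    if y.1 = y.2 then
      (if x = y then (-1 : K) ^ p y.1 * q ^ (1 - 2 * (p y.1 : ℤ)) else 0)
    else
      (if x.1 = y.2 ∧ x.2 = y.1 then (-1 : K) ^ (p y.1 * p y.2) else 0)
        + (if x = y ∧ y.1 < y.2 then q - q⁻¹ else 0)

/-- The operator `R ⊗ I` on `K^N ⊗ K^N ⊗ K^N`, acting by the Hecke symmetry in positions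
`(1,2)`. -/
noncomputable def heckeR12 (K : Type*) [Field K] (q : K) (m n : ℕ) :
    Matrix (Fin (m + n) × Fin (m + n) × Fin (m + n))
      (Fin (m + n) × Fin (m + n) × Fin (m + n)) K :=
  Matrix.of fun x y =>
    heckeR K q m n (x.1, x.2.1) (y.1, y.2.1) * (if x.2.2 = y.2.2 then 1 else 0)

/-- The operator `I ⊗ R` on `K^N ⊗ K^N ⊗ K^N`, acting by the Hecke symmetry in positions
`(2,3)`. -/
noncomputable def heckeR23 (K : Type*) [Field K] (q : K) (m n : ℕ) :
    Matrix (Fin (m + n) × Fin (m + n) × Fin (m + n))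
      (Fin (m + n) × Fin (m + n) × Fin (m + n)) K :=
  Matrix.of fun x y =>
    (if x.1 = y.1 then 1 else 0) * heckeR K q m n (x.2.1, x.2.2) (y.2.1, y.2.2)

/-- Two operators which act on a family `e i j k` as a two-parameter Hecke symmetry in positions
`(1,2)` and `(2,3)` respectively satisfy the braid relation on that family. -/
theorem braid_apply_of_hecke_action {K V ι : Type*} [CommRing K] [AddCommGroup V] [Module K V]
    [LinearOrder ι] (e : ι → ι → ι → V) (a b : ι → ι → K) (c : K) (A B : V →ₗ[K] V)
    (hA : ∀ i j k, A (e i j k) = a i j • e j i k + b i j • e i j k)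
    (hB : ∀ i j k, B (e i j k) = a j k • e i k j + b j k • e i j k)
    (ha_comm : ∀ i j, a i j = a j i) (ha_sq : ∀ i j, i ≠ j → a i j ^ 2 = 1)
    (ha_diag : ∀ i, a i i ^ 2 = c * a i i + 1)
    (hb_lt : ∀ i j, i < j → b i j = c) (hb_le : ∀ i j, j ≤ i → b i j = 0) (i j k : ι) :
    A (B (A (e i j k))) = B (A (B (e i j k))) := by
  simp only [hA, hB, map_add, map_smul]
  rw [ha_comm j i, ha_comm k j]
  rcases lt_trichotomy i j with hij | rfl | hij
  · rcases lt_trichotomy j k with hjk | rfl | hjk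
    · have hik := hij.trans hjk
      simp only [hb_lt _ _ hij, hb_lt _ _ hjk, hb_lt _ _ hik, hb_le _ _ hij.le, hb_le _ _ hjk.le]
      linear_combination (norm := module)
        (c • ha_sq i j hij.ne) • e i j k - (c • ha_sq j k hjk.ne) • e i j k
    · simp only [hb_lt _ _ hij, hb_le _ _ hij.le, hb_le _ _ le_rfl]
      linear_combination (norm := module)
        (c • ha_sq i j hij.ne) • e i j j - (c • ha_diag j) • e i j j
    · rcases lt_trichotomy i k with hik | rfl | hik
      · simp only [hb_lt _ _ hij, hb_lt _ _ hjk, hb_lt _ _ hik, hb_le _ _ hij.le, hb_le _ _ hjk.le]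
        linear_combination (norm := module)
          (c • ha_sq i j hij.ne) • e i j k - (c • ha_sq j k hjk.ne') • e i j k
      · simp only [hb_lt _ _ hij, hb_le _ _ hij.le, hb_le _ _ le_rfl, ha_comm j i]
        module
      · simp only [hb_lt _ _ hij, hb_lt _ _ hjk, hb_le _ _ hik.le, hb_le _ _ hij.le,
          hb_le _ _ hjk.le]
        module
  · rcases lt_trichotomy i k with hik | rfl | hik
    · simp only [hb_lt _ _ hik, hb_le _ _ hik.le, hb_le _ _ le_rfl]
      linear_combination (norm := module)
        (c • ha_diag i) • e i i k - (c • ha_sq i k hik.ne) • e i i k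
    · rfl
    · simp only [hb_lt _ _ hik, hb_le _ _ hik.le, hb_le _ _ le_rfl]
      module
  · rcases lt_trichotomy j k with hjk | rfl | hjk
    · rcases lt_trichotomy i k with hik | rfl | hik
      · simp only [hb_lt _ _ hij, hb_lt _ _ hjk, hb_lt _ _ hik, hb_le _ _ hij.le, hb_le _ _ hjk.le]
        linear_combination (norm := module)
          (c • ha_sq i j hij.ne') • e i j k - (c • ha_sq j k hjk.ne) • e i j k
      · simp only [hb_lt _ _ hij, hb_le _ _ hij.le, hb_le _ _ le_rfl, ha_comm j i]
        module
      · simp only [hb_lt _ _ hij, hb_lt _ _ hjk, hb_le _ _ hik.le, hb_le _ _ hij.le,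
          hb_le _ _ hjk.le]
        module
    · simp only [hb_lt _ _ hij, hb_le _ _ hij.le, hb_le _ _ le_rfl]
      module
    · have hik := hjk.trans hij
      simp only [hb_lt _ _ hij, hb_lt _ _ hjk, hb_le _ _ hik.le, hb_le _ _ hij.le, hb_le _ _ hjk.le]
      module

/-- The coefficient of `e_j ⊗ e_i` in the image of `e_i ⊗ e_j` under the Hecke symmetry. -/
noncomputable def heckeSwapCoeff (K : Type*) [Field K] (q : K) (m n : ℕ)
    (i j : Fin (m + n)) : K :=
  if i = j then (if (i : ℕ) < m then q else -q⁻¹)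
  else if (i : ℕ) < m ∨ (j : ℕ) < m then 1 else -1

theorem heckeR_apply (K : Type*) [Field K] (q : K) (m n : ℕ) (i j r s : Fin (m + n)) :
    heckeR K q m n (r, s) (i, j)
      = heckeSwapCoeff K q m n i j * (if r = j ∧ s = i then 1 else 0)
        + (if i < j then q - q⁻¹ else 0) * (if r = i ∧ s = j then 1 else 0) := by
  rcases eq_or_ne i j with rfl | hij
  · by_cases hi : (i : ℕ) < m <;> simp [heckeR, heckeSwapCoeff, hi]
  · by_cases hi : (i : ℕ) < m <;> by_cases hj : (j : ℕ) < m <;>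
      simp [heckeR, heckeSwapCoeff, hi, hj, hij, ite_and]

theorem heckeR12_mulVecLin_single (K : Type*) [Field K] (q : K) (m n : ℕ) (i j k : Fin (m + n)) :
    (heckeR12 K q m n).mulVecLin (Pi.single (i, j, k) (1 : K))
      = heckeSwapCoeff K q m n i j • Pi.single (j, i, k) 1
        + (if i < j then q - q⁻¹ else 0) • Pi.single (i, j, k) 1 := by
  ext ⟨r, s, t⟩
  by_cases ht : t = k <;> by_cases hij : i < j <;>
    simp [heckeR12, heckeR_apply, Pi.single_apply, ht, hij]

theorem heckeR23_mulVecLin_single (K : Type*) [Field K] (q : K) (m n : ℕ) (i j k : Fin (m + n)) :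
    (heckeR23 K q m n).mulVecLin (Pi.single (i, j, k) (1 : K))
      = heckeSwapCoeff K q m n j k • Pi.single (i, k, j) 1
        + (if j < k then q - q⁻¹ else 0) • Pi.single (i, j, k) 1 := by
  ext ⟨r, s, t⟩
  by_cases hr : r = i <;> by_cases hjk : j < k <;>
    simp [heckeR23, heckeR_apply, Pi.single_apply, hr, hjk]

/-- The Hecke symmetry of `GL(m|n)` type satisfies the quantum Yang–Baxter (braid) equation
`(R ⊗ I)(I ⊗ R)(R ⊗ I) = (I ⊗ R)(R ⊗ I)(I ⊗ R)` on `K^N ⊗ K^N ⊗ K^N`. -/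
theorem heckeR_yang_baxter (K : Type*) [Field K] (q : K) (hq : q ≠ 0)
    (m n : ℕ) (hN : 1 ≤ m + n) :
    heckeR12 K q m n * heckeR23 K q m n * heckeR12 K q m n
      = heckeR23 K q m n * heckeR12 K q m n * heckeR23 K q m n := by
  refine Matrix.ext_of_mulVec_single ?_
  rintro ⟨i, j, k⟩
  have h := braid_apply_of_hecke_action (V := Fin (m + n) × Fin (m + n) × Fin (m + n) → K)
    (fun i j k => Pi.single (i, j, k) (1 : K))
    (heckeSwapCoeff K q m n) (fun i j => if i < j then q - q⁻¹ else 0) (q - q⁻¹) _ _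
    (heckeR12_mulVecLin_single K q m n) (heckeR23_mulVecLin_single K q m n)
    (fun i j => ?_) (fun i j hij => ?_) (fun i => ?_)
    (fun i j hij => if_pos hij) (fun i j hij => if_neg hij.not_gt) i j k
  · simpa only [Matrix.mulVecLin_apply, Matrix.mulVec_mulVec, Matrix.mul_assoc] using h
  · rcases eq_or_ne i j with rfl | hij
    · rfl
    · simp [heckeSwapCoeff, hij, hij.symm, or_comm]
  · simp only [heckeSwapCoeff, if_neg hij]
    split_ifs <;> ring
  · simp only [heckeSwapCoeff, if_true]
    split_ifs <;> field_simp <;> ring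
end

section
/- Let K be a field, q ∈ K a unit, ħ ∈ K, and set λ = q − q⁻¹. Let R be an associative unital K-algebra containing elements a, b, c, d satisfying q·ab − q⁻¹·ba = ħ·b, q·ca − q⁻¹·ac = ħ·c, ad = da, q·(bc − cb) = (λ·a − ħ)·(d − a), q·(cd − dc) = c·(λ·a − ħ), and q·(db − bd) = (λ·a − ħ)·b. Then the element ℓ = q⁻³·a + q⁻¹·d commutes with each of a, b, c, d. -/
/-- In the modified Reflection Equation Algebra `ℒ(ħ,q)` of `GL(2)` type, i.e. in any
associative unital `K`-algebra containing elements `a, b, c, d` (the entries of the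
generating matrix `L = [[a,b],[c,d]]`) subject to the relations
`q·ab − q⁻¹·ba = ħ·b`, `q·ca − q⁻¹·ac = ħ·c`, `ad = da`,
`q·(bc − cb) = (λ·a − ħ)·(d − a)`, `q·(cd − dc) = c·(λ·a − ħ)`,
`q·(db − bd) = (λ·a − ħ)·b` (with `λ = q − q⁻¹`),
the linear braided Casimir element `ℓ = Tr_R L = q⁻³·a + q⁻¹·d` commutes with each of
`a, b, c, d`. -/
theorem rea_gl2_linear_casimir_commutes {K A : Type*} [Field K] [Ring A] [Algebra K A]
    (q hbar : K) (hq : q ≠ 0) (a b c d : A)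
    (r1 : algebraMap K A q * (a * b) - algebraMap K A q⁻¹ * (b * a) = algebraMap K A hbar * b)
    (r2 : algebraMap K A q * (c * a) - algebraMap K A q⁻¹ * (a * c) = algebraMap K A hbar * c)
    (r3 : a * d = d * a)
    (r4 : algebraMap K A q * (b * c - c * b)
            = (algebraMap K A (q - q⁻¹) * a - algebraMap K A hbar) * (d - a))
    (r5 : algebraMap K A q * (c * d - d * c)
            = c * (algebraMap K A (q - q⁻¹) * a - algebraMap K A hbar))
    (r6 : algebraMap K A q * (d * b - b * d)
            = (algebraMap K A (q - q⁻¹) * a - algebraMap K A hbar) * b) :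
    (algebraMap K A (q⁻¹ ^ 3) * a + algebraMap K A q⁻¹ * d) * a
        = a * (algebraMap K A (q⁻¹ ^ 3) * a + algebraMap K A q⁻¹ * d) ∧
    (algebraMap K A (q⁻¹ ^ 3) * a + algebraMap K A q⁻¹ * d) * b
        = b * (algebraMap K A (q⁻¹ ^ 3) * a + algebraMap K A q⁻¹ * d) ∧
    (algebraMap K A (q⁻¹ ^ 3) * a + algebraMap K A q⁻¹ * d) * c
        = c * (algebraMap K A (q⁻¹ ^ 3) * a + algebraMap K A q⁻¹ * d) ∧
    (algebraMap K A (q⁻¹ ^ 3) * a + algebraMap K A q⁻¹ * d) * d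
        = d * (algebraMap K A (q⁻¹ ^ 3) * a + algebraMap K A q⁻¹ * d) := by
  simp only [Algebra.algebraMap_eq_smul_one, sub_mul, mul_sub, add_mul, mul_add,
    smul_mul_assoc, mul_smul_comm, one_mul, mul_one] at *
  refine ⟨?_, ?_, ?_, ?_⟩
  · rw [r3]
  · linear_combination (norm := skip) (q⁻¹ ^ 2) • r6 + (q⁻¹ ^ 2) • r1
    match_scalars <;> field_simp <;> ring
  · linear_combination (norm := skip) (-q⁻¹ ^ 2) • r5 + (-q⁻¹ ^ 2) • r2
    match_scalars <;> field_simp <;> ring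
  · rw [r3]
end

section
/- Let K be a field, q ∈ K a unit, ħ ∈ K, and set λ = q − q⁻¹. Let R be an associative unital K-algebra containing elements a, b, c, d satisfying q·ab − q⁻¹·ba = ħ·b, q·ca − q⁻¹·ac = ħ·c, ad = da, q·(bc − cb) = (λ·a − ħ)·(d − a), q·(cd − dc) = c·(λ·a − ħ), and q·(db − bd) = (λ·a − ħ)·b. Then the quadratic braided Casimir element Tr_R L² = q⁻³·(a² + bc) + q⁻¹·(cb + d²) commutes with each of a, b, c, d. -/
section QuadraticCasimir

variable {K A : Type*} [Field K] [Ring A] [Algebra K A] {u v : K} {a b c d : A}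

theorem commute_mul_of_twisted_left (hu : u ≠ 0)
    (hab : b * a = u • (a * b) - v • b) (hac : a * c = u • (c * a) - v • c) :
    Commute (b * c) a := by
  refine smul_right_injective A hu ?_
  linear_combination (norm :=
      (simp only [sub_mul, mul_sub, smul_mul_assoc, mul_smul_comm, mul_assoc]; module))
    hab * c - b * hac

theorem commute_mul_of_twisted_right
    (hab : b * a = u • (a * b) - v • b) (hac : a * c = u • (c * a) - v • c) :
    Commute (c * b) a := by
  change c * b * a = a * (c * b)
  linear_combination (norm :=
      (simp only [sub_mul, mul_sub, smul_mul_assoc, mul_smul_comm, mul_assoc]; module))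
    c * hab - hac * b

/-- The quadratic Casimir element `a² + bc + u(cb + d²)` commutes with `a`. -/
theorem commute_casimir_a (hu : u ≠ 0)
    (hab : b * a = u • (a * b) - v • b) (hac : a * c = u • (c * a) - v • c)
    (had : Commute a d) :
    Commute (a ^ 2 + b * c + u • (c * b + d ^ 2)) a :=
  (((Commute.refl a).pow_left 2).add_left (commute_mul_of_twisted_left hu hab hac)).add_left
    (((commute_mul_of_twisted_right hab hac).add_left (had.symm.pow_left 2)).smul_left u)

/-- The quadratic Casimir element `a² + bc + u(cb + d²)` commutes with `b`. -/
theorem commute_casimir_b (hu : u ≠ 0)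
    (hab : b * a = u • (a * b) - v • b) (had : a * d = d * a)
    (hbc : u • (b * c - c * b) = ((u - 1) • a - v • 1) * (d - a))
    (hdb : u • (d * b - b * d) = ((u - 1) • a - v • 1) * b) :
    Commute (a ^ 2 + b * c + u • (c * b + d ^ 2)) b := by
  refine Eq.symm (smul_right_injective A hu ?_)
  linear_combination (norm := (simp only [pow_two, mul_sub, sub_mul, mul_add, add_mul,
      mul_assoc, smul_mul_assoc, mul_smul_comm, one_mul]; module))
    b * hbc + u • (hbc * b) - u • (hdb * d + d * hdb)
      + u • (hab * a + u • (a * hab) - v • hab) + (u - 1) • (hab * (d - a))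
      - u • (((u - 1) • a - v • 1) * hab) + (u * (u - 1)) • (had * b)

/-- The quadratic Casimir element `a² + bc + u(cb + d²)` commutes with `c`. -/
theorem commute_casimir_c (hu : u ≠ 0)
    (hac : a * c = u • (c * a) - v • c) (had : a * d = d * a)
    (hbc : u • (b * c - c * b) = ((u - 1) • a - v • 1) * (d - a))
    (hcd : u • (c * d - d * c) = c * ((u - 1) • a - v • 1)) :
    Commute (a ^ 2 + b * c + u • (c * b + d ^ 2)) c := by
  refine smul_right_injective A hu ?_
  linear_combination (norm := (simp only [pow_two, mul_sub, sub_mul, mul_add, add_mul,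
      mul_assoc, smul_mul_assoc, mul_smul_comm, mul_one, one_mul]; module))
    hbc * c + u • (c * hbc) - u • (hcd * d + d * hcd)
      + u • (a * hac + u • (hac * a) - v • hac) + (u - 1) • (had * c) + (u - 1) • (d * hac)
      - (u - 1) • (a * hac) - u • (hac * ((u - 1) • a - v • 1))

/-- The quadratic Casimir element `a² + bc + u(cb + d²)` commutes with `d`. -/
theorem commute_casimir_d (hu : u ≠ 0)
    (hab : b * a = u • (a * b) - v • b) (hac : a * c = u • (c * a) - v • c)
    (had : Commute a d)
    (hcd : u • (c * d - d * c) = c * ((u - 1) • a - v • 1))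
    (hdb : u • (d * b - b * d) = ((u - 1) • a - v • 1) * b) :
    Commute (a ^ 2 + b * c + u • (c * b + d ^ 2)) d := by
  have hbcd : Commute (b * c) d := by
    refine smul_right_injective A hu ?_
    linear_combination (norm := (simp only [mul_sub, sub_mul, mul_assoc, smul_mul_assoc,
      mul_smul_comm, mul_one, one_mul]; module))
      b * hcd - hdb * c + (u - 1) • (commute_mul_of_twisted_left hu hab hac).eq
  have hcbd : Commute (c * b) d := by
    refine smul_right_injective A hu ?_
    linear_combination (norm := (simp only [mul_sub, sub_mul, mul_assoc, smul_mul_assoc,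
      mul_smul_comm, mul_one, one_mul]; module))
      hcd * b - c * hdb
  exact ((had.pow_left 2).add_left hbcd).add_left
    ((hcbd.add_left ((Commute.refl d).pow_left 2)).smul_left u)

end QuadraticCasimir

/-- In the modified Reflection Equation Algebra `ℒ(ħ,q)` of `GL(2)` type, i.e. in any
associative unital `K`-algebra containing elements `a, b, c, d` (the entries of the
generating matrix `L = [[a,b],[c,d]]`) subject to the relations
`q·ab − q⁻¹·ba = ħ·b`, `q·ca − q⁻¹·ac = ħ·c`, `ad = da`,
`q·(bc − cb) = (λ·a − ħ)·(d − a)`, `q·(cd − dc) = c·(λ·a − ħ)`,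
`q·(db − bd) = (λ·a − ħ)·b` (with `λ = q − q⁻¹`),
the quadratic braided Casimir element `Tr_R L² = q⁻³·(a² + bc) + q⁻¹·(cb + d²)` commutes
with each of `a, b, c, d`. -/
theorem rea_gl2_quadratic_casimir_commutes {K A : Type*} [Field K] [Ring A] [Algebra K A]
    (q hbar : K) (hq : q ≠ 0) (a b c d : A)
    (r1 : algebraMap K A q * (a * b) - algebraMap K A q⁻¹ * (b * a) = algebraMap K A hbar * b)
    (r2 : algebraMap K A q * (c * a) - algebraMap K A q⁻¹ * (a * c) = algebraMap K A hbar * c)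
    (r3 : a * d = d * a)
    (r4 : algebraMap K A q * (b * c - c * b)
            = (algebraMap K A (q - q⁻¹) * a - algebraMap K A hbar) * (d - a))
    (r5 : algebraMap K A q * (c * d - d * c)
            = c * (algebraMap K A (q - q⁻¹) * a - algebraMap K A hbar))
    (r6 : algebraMap K A q * (d * b - b * d)
            = (algebraMap K A (q - q⁻¹) * a - algebraMap K A hbar) * b) :
    (algebraMap K A (q⁻¹ ^ 3) * (a ^ 2 + b * c) + algebraMap K A q⁻¹ * (c * b + d ^ 2)) * a
        = a * (algebraMap K A (q⁻¹ ^ 3) * (a ^ 2 + b * c)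
            + algebraMap K A q⁻¹ * (c * b + d ^ 2)) ∧
    (algebraMap K A (q⁻¹ ^ 3) * (a ^ 2 + b * c) + algebraMap K A q⁻¹ * (c * b + d ^ 2)) * b
        = b * (algebraMap K A (q⁻¹ ^ 3) * (a ^ 2 + b * c)
            + algebraMap K A q⁻¹ * (c * b + d ^ 2)) ∧
    (algebraMap K A (q⁻¹ ^ 3) * (a ^ 2 + b * c) + algebraMap K A q⁻¹ * (c * b + d ^ 2)) * c
        = c * (algebraMap K A (q⁻¹ ^ 3) * (a ^ 2 + b * c)
            + algebraMap K A q⁻¹ * (c * b + d ^ 2)) ∧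
    (algebraMap K A (q⁻¹ ^ 3) * (a ^ 2 + b * c) + algebraMap K A q⁻¹ * (c * b + d ^ 2)) * d
        = d * (algebraMap K A (q⁻¹ ^ 3) * (a ^ 2 + b * c)
            + algebraMap K A q⁻¹ * (c * b + d ^ 2)) := by
  simp only [← Algebra.smul_def, Algebra.algebraMap_eq_smul_one hbar] at r1 r2 r4 r5 r6 ⊢
  have hu : q ^ 2 ≠ 0 := pow_ne_zero 2 hq
  have hq1 : q * q⁻¹ = 1 := mul_inv_cancel₀ hq
  have hq2 : q * (q - q⁻¹) = q ^ 2 - 1 := by rw [mul_sub, hq1, pow_two]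
  have hab : b * a = q ^ 2 • (a * b) - (q * hbar) • b := by
    have h := congrArg (q • ·) r1
    simp only [smul_mul_assoc, one_mul, smul_sub, smul_smul, hq1, one_smul] at h
    rw [pow_two, ← h, sub_sub_cancel]
  have hac : a * c = q ^ 2 • (c * a) - (q * hbar) • c := by
    have h := congrArg (q • ·) r2
    simp only [smul_mul_assoc, one_mul, smul_sub, smul_smul, hq1, one_smul] at h
    rw [pow_two, ← h, sub_sub_cancel]
  have ht : q • ((q - q⁻¹) • a - hbar • (1 : A)) = (q ^ 2 - 1) • a - (q * hbar) • 1 := by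
    rw [smul_sub, smul_smul, smul_smul, hq2]
  have hbc : q ^ 2 • (b * c - c * b) = ((q ^ 2 - 1) • a - (q * hbar) • 1) * (d - a) := by
    rw [pow_two, mul_smul, r4, ← smul_mul_assoc, ht, pow_two]
  have hcd : q ^ 2 • (c * d - d * c) = c * ((q ^ 2 - 1) • a - (q * hbar) • 1) := by
    rw [pow_two, mul_smul, r5, ← mul_smul_comm, ht, pow_two]
  have hdb : q ^ 2 • (d * b - b * d) = ((q ^ 2 - 1) • a - (q * hbar) • 1) * b := by
    rw [pow_two, mul_smul, r6, ← smul_mul_assoc, ht, pow_two]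
  have hX : q⁻¹ ^ 3 • (a ^ 2 + b * c) + q⁻¹ • (c * b + d ^ 2)
      = q⁻¹ ^ 3 • (a ^ 2 + b * c + q ^ 2 • (c * b + d ^ 2)) := by
    have hq3 : q⁻¹ ^ 3 * q ^ 2 = q⁻¹ := by field_simp
    rw [smul_add _ (a ^ 2 + b * c), smul_smul, hq3]
  rw [hX]
  exact ⟨(commute_casimir_a hu hab hac r3).smul_left _,
    (commute_casimir_b hu hab r3 hbc hdb).smul_left _,
    (commute_casimir_c hu hac r3 hbc hcd).smul_left _,
    (commute_casimir_d hu hab hac r3 hcd hdb).smul_left _⟩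
end

section
/- Let K be a field, q ∈ K a unit, and set λ = q − q⁻¹. Let R be an associative unital K-algebra containing elements a, b, c, d satisfying the Reflection Equation Algebra relations q·ab = q⁻¹·ba, q·ca = q⁻¹·ac, ad = da, q·(bc − cb) = λ·a·(d − a), q·(cd − dc) = λ·c·a, and q·(db − bd) = λ·a·b. Then the 2×2 matrix L = [[a,b],[c,d]] over R satisfies the Cayley–Hamilton identity L² − (q⁻²·a + d)·L + (q⁻²·ad − cb)·I = 0, where the scalar coefficients multiply each matrix entry on the left and I is the 2×2 identity matrix. -/
/-- In the Reflection Equation Algebra `ℒ(q)` of `GL(2)` type, i.e. in any associative unital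
`K`-algebra containing elements `a, b, c, d` subject to the relations
`q·ab = q⁻¹·ba`, `q·ca = q⁻¹·ac`, `ad = da`, `q·(bc − cb) = λ·a·(d − a)`,
`q·(cd − dc) = λ·c·a`, `q·(db − bd) = λ·a·b` (with `λ = q − q⁻¹`),
the generating matrix `L = [[a,b],[c,d]]` satisfies the Cayley–Hamilton identity
`L² − (q⁻²·a + d)·L + (q⁻²·ad − cb)·I = 0`, where the scalar coefficients multiply each
matrix entry on the left. -/
theorem rea_gl2_cayley_hamilton {K A : Type*} [Field K] [Ring A] [Algebra K A]
    (q : K) (hq : q ≠ 0) (a b c d : A)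
    (r1 : algebraMap K A q * (a * b) = algebraMap K A q⁻¹ * (b * a))
    (r2 : algebraMap K A q * (c * a) = algebraMap K A q⁻¹ * (a * c))
    (r3 : a * d = d * a)
    (r4 : algebraMap K A q * (b * c - c * b) = algebraMap K A (q - q⁻¹) * (a * (d - a)))
    (r5 : algebraMap K A q * (c * d - d * c) = algebraMap K A (q - q⁻¹) * (c * a))
    (r6 : algebraMap K A q * (d * b - b * d) = algebraMap K A (q - q⁻¹) * (a * b)) :
    (!![a, b; c, d] : Matrix (Fin 2) (Fin 2) A) * !![a, b; c, d]
        - (algebraMap K A (q⁻¹ ^ 2) * a + d) • !![a, b; c, d]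
        + (algebraMap K A (q⁻¹ ^ 2) * (a * d) - c * b) • (1 : Matrix (Fin 2) (Fin 2) A)
      = 0 := by
  have hsq : (1 : K) - q⁻¹ ^ 2 = q⁻¹ * (q - q⁻¹) := by field_simp
  have cancel_left {μ : K} {x y : A} (h : algebraMap K A q * x = algebraMap K A μ * y) :
      x = (q⁻¹ * μ) • y := by
    rw [← Algebra.smul_def, ← Algebra.smul_def] at h
    rw [mul_smul, ← h, inv_smul_smul₀ hq]
  have hca := cancel_left r2
  have hbc := cancel_left r4
  have hdb := cancel_left r6
  rw [← pow_two] at hca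
  rw [← hsq, sub_smul, one_smul] at hbc hdb
  simp only [← Algebra.smul_def]
  ext i j
  fin_cases i <;> fin_cases j <;> simp [add_mul, hca] <;> simp only [← inv_pow]
  · rw [sub_eq_iff_eq_add] at hbc
    rw [hbc, ← r3, mul_sub, smul_sub]
    abel
  · rw [sub_eq_iff_eq_add] at hdb
    rw [hdb]
    abel
end

section
/- Let K be a field, q ∈ K a unit, and set λ = q − q⁻¹. Let R be an associative unital K-algebra containing elements a, b, c, d satisfying q·ab = q⁻¹·ba, q·ca = q⁻¹·ac, ad = da, q·(bc − cb) = λ·a·(d − a), q·(cd − dc) = λ·c·a, and q·(db − bd) = λ·a·b. Then the Cayley–Hamilton coefficients μ₁ + μ₂ = q⁻²·a + d and μ₁·μ₂ = q⁻²·ad − cb each commute with a, b, c, d. -/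
/-- In the Reflection Equation Algebra `ℒ(q)` of `GL(2)` type, with generating matrix
`L = [[a,b],[c,d]]` satisfying `L² − (q⁻²a+d)L + (q⁻²ad−cb)I = 0`, the Cayley–Hamilton
coefficients `μ₁ + μ₂ = q⁻²·a + d` and `μ₁·μ₂ = q⁻²·ad − cb` each commute with
`a, b, c, d`. -/
theorem rea_gl2_ch_coefficients_commute {K A : Type*} [Field K] [Ring A] [Algebra K A]
    (q : K) (hq : q ≠ 0) (a b c d : A)
    (r1 : algebraMap K A q * (a * b) = algebraMap K A q⁻¹ * (b * a))
    (r2 : algebraMap K A q * (c * a) = algebraMap K A q⁻¹ * (a * c))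
    (r3 : a * d = d * a)
    (r4 : algebraMap K A q * (b * c - c * b) = algebraMap K A (q - q⁻¹) * (a * (d - a)))
    (r5 : algebraMap K A q * (c * d - d * c) = algebraMap K A (q - q⁻¹) * (c * a))
    (r6 : algebraMap K A q * (d * b - b * d) = algebraMap K A (q - q⁻¹) * (a * b)) :
    ((algebraMap K A (q⁻¹ ^ 2) * a + d) * a = a * (algebraMap K A (q⁻¹ ^ 2) * a + d) ∧
     (algebraMap K A (q⁻¹ ^ 2) * a + d) * b = b * (algebraMap K A (q⁻¹ ^ 2) * a + d) ∧
     (algebraMap K A (q⁻¹ ^ 2) * a + d) * c = c * (algebraMap K A (q⁻¹ ^ 2) * a + d) ∧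
     (algebraMap K A (q⁻¹ ^ 2) * a + d) * d = d * (algebraMap K A (q⁻¹ ^ 2) * a + d)) ∧
    ((algebraMap K A (q⁻¹ ^ 2) * (a * d) - c * b) * a
        = a * (algebraMap K A (q⁻¹ ^ 2) * (a * d) - c * b) ∧
     (algebraMap K A (q⁻¹ ^ 2) * (a * d) - c * b) * b
        = b * (algebraMap K A (q⁻¹ ^ 2) * (a * d) - c * b) ∧
     (algebraMap K A (q⁻¹ ^ 2) * (a * d) - c * b) * c
        = c * (algebraMap K A (q⁻¹ ^ 2) * (a * d) - c * b) ∧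
     (algebraMap K A (q⁻¹ ^ 2) * (a * d) - c * b) * d
        = d * (algebraMap K A (q⁻¹ ^ 2) * (a * d) - c * b)) := by
  have cancel (x y : A) (h : algebraMap K A q * x = algebraMap K A q * y) : x = y := by
    simpa [← Algebra.smul_def, hq] using h
  have ba : b * a = q ^ 2 • (a * b) := by
    have h := congrArg (q • ·) r1
    simp only [← Algebra.smul_def, smul_smul, mul_inv_cancel₀ hq, one_smul] at h
    rw [← h, sq]
  have ac : a * c = q ^ 2 • (c * a) := by
    have h := congrArg (q • ·) r2
    simp only [← Algebra.smul_def, smul_smul, mul_inv_cancel₀ hq, one_smul] at h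
    rw [← h, sq]
  have scalar (x : A) :
      algebraMap K A (q - q⁻¹) * x = algebraMap K A q * ((1 - q⁻¹ ^ 2) • x) := by
    simp only [← Algebra.smul_def, smul_smul]
    congr 1
    field_simp
  have bc : b * c = c * b + (1 - q⁻¹ ^ 2) • (a * (d - a)) := by
    rw [← cancel _ _ (r4.trans (scalar _))]; abel
  have dc : d * c = c * d - (1 - q⁻¹ ^ 2) • (c * a) := by
    rw [← cancel _ _ (r5.trans (scalar _))]; abel
  have bd : b * d = d * b - (1 - q⁻¹ ^ 2) • (a * b) := by
    rw [← cancel _ _ (r6.trans (scalar _))]; abel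
  -- Rewriting to the normal order `c, a, d, b`, also inside right-associated products.
  have assoc {x y z : A} (h : x * y = z) (w : A) : x * (y * w) = z * w := by
    rw [← mul_assoc, h]
  refine ⟨⟨?_, ?_, ?_, ?_⟩, ?_, ?_, ?_, ?_⟩
  all_goals
    simp only [← Algebra.smul_def, add_mul, mul_add, sub_mul, mul_sub, smul_mul_assoc,
      mul_smul_comm, mul_assoc, smul_sub, ba, assoc ba, ac, assoc ac, r3.symm,
      assoc r3.symm, bc, assoc bc, dc, assoc dc, bd] <;>
    match_scalars <;> field_simp <;> ring
end

section
/- Let K be a field, q ∈ K a unit with 2_q := q + q⁻¹ invertible, ħ ∈ K, and set λ = q − q⁻¹. Let R be an associative unital K-algebra containing elements a, b, c, d satisfying q·ab − q⁻¹·ba = ħ·b, q·ca − q⁻¹·ac = ħ·c, ad = da, q·(bc − cb) = (λ·a − ħ)·(d − a), q·(cd − dc) = c·(λ·a − ħ), q·(db − bd) = (λ·a − ħ)·b, together with the traceless condition q⁻³·a + q⁻¹·d = 0. Then, setting h = a − d, the elements h, b, c satisfy q²·hb − bh = 2_q·ħ·b, q²·ch − hc = 2_q·ħ·c, and (q²+1)·(bc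 − cb) + (q²−1)·h² = 2_q·ħ·h. -/
/-- Passing to the quotient `𝒮ℒ(ħ,q) = ℒ(ħ,q)/⟨ℓ⟩` of the modified Reflection Equation
Algebra of `GL(2)` type by its linear braided Casimir `ℓ = q⁻³·a + q⁻¹·d`: in any associative
unital `K`-algebra containing `a, b, c, d` subject to the modified REA relations
`q·ab − q⁻¹·ba = ħ·b`, `q·ca − q⁻¹·ac = ħ·c`, `ad = da`,
`q·(bc − cb) = (λ·a − ħ)·(d − a)`, `q·(cd − dc) = c·(λ·a − ħ)`,
`q·(db − bd) = (λ·a − ħ)·b` (with `λ = q − q⁻¹`) together with the traceless condition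
`q⁻³·a + q⁻¹·d = 0`, the elements `h = a − d`, `b`, `c` satisfy
`q²·hb − bh = 2_q·ħ·b`, `q²·ch − hc = 2_q·ħ·c`, and
`(q²+1)·(bc − cb) + (q²−1)·h² = 2_q·ħ·h` (with `2_q = q + q⁻¹`). -/
theorem mrea_gl2_traceless_quotient_relations {K A : Type*} [Field K] [Ring A] [Algebra K A]
    (q hbar : K) (hq : q ≠ 0) (h2q : q + q⁻¹ ≠ 0) (a b c d : A)
    (r1 : algebraMap K A q * (a * b) - algebraMap K A q⁻¹ * (b * a) = algebraMap K A hbar * b)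
    (r2 : algebraMap K A q * (c * a) - algebraMap K A q⁻¹ * (a * c) = algebraMap K A hbar * c)
    (r3 : a * d = d * a)
    (r4 : algebraMap K A q * (b * c - c * b)
            = (algebraMap K A (q - q⁻¹) * a - algebraMap K A hbar) * (d - a))
    (r5 : algebraMap K A q * (c * d - d * c)
            = c * (algebraMap K A (q - q⁻¹) * a - algebraMap K A hbar))
    (r6 : algebraMap K A q * (d * b - b * d)
            = (algebraMap K A (q - q⁻¹) * a - algebraMap K A hbar) * b)
    (rtr : algebraMap K A (q⁻¹ ^ 3) * a + algebraMap K A q⁻¹ * d = 0) :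
    algebraMap K A (q ^ 2) * ((a - d) * b) - b * (a - d)
        = algebraMap K A ((q + q⁻¹) * hbar) * b ∧
    algebraMap K A (q ^ 2) * (c * (a - d)) - (a - d) * c
        = algebraMap K A ((q + q⁻¹) * hbar) * c ∧
    algebraMap K A (q ^ 2 + 1) * (b * c - c * b)
        + algebraMap K A (q ^ 2 - 1) * (a - d) ^ 2
        = algebraMap K A ((q + q⁻¹) * hbar) * (a - d) := by
  simp only [Algebra.algebraMap_eq_smul_one, smul_mul_assoc, one_mul, sub_mul, mul_sub]
    at r1 r2 r4 rtr ⊢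
  obtain rfl : d = -(q⁻¹ ^ 2) • a := by
    have h := congrArg (q • ·) rtr
    simp only [smul_add, smul_smul, smul_zero, mul_inv_cancel₀ hq, one_smul] at h
    rw [eq_neg_of_add_eq_zero_right h, neg_smul]
    congr 2
    field_simp
  simp only [pow_two (a - _), sub_mul, mul_sub, smul_mul_assoc, mul_smul_comm] at r4 ⊢
  refine ⟨?_, ?_, ?_⟩
  · linear_combination (norm := skip) (q + q⁻¹) • r1
    match_scalars <;> field_simp <;> ring
  · linear_combination (norm := skip) (q + q⁻¹) • r2
    match_scalars <;> field_simp <;> ring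
  · linear_combination (norm := skip) (q + q⁻¹) • r4
    match_scalars <;> field_simp <;> ring
end

section
/- Let K be a field and q ∈ K a unit with 2_q := q + q⁻¹ invertible. Let R be an associative unital K-algebra containing elements a, b, c, d satisfying q²·ab = ba, q²·ca = ac, ad = da, b² = 0, c² = 0, q⁻¹·bc + q·cb = (q − q⁻¹)·a·(a − d), bd − db = (q²−1)·ab, and cd − dc = −(q²−1)·ca. Set ℓ = q·(a − d), T = q·(a² + bc − cb − d²), S = (2_q)⁻¹·(q⁻¹·ℓ² + T), and A = (2_q)⁻¹·(q·ℓ² − T). Then the 2×2 matrix L = [[a,b],[c,d]] satisfies the factorized Cayley–Hamilton identity (ℓ·L − q·S·I)·(ℓ·L + q⁻¹·A·I) = 0, where scalar coefficients multiply matrix entries on the left and I is the 2×2 identity matrix. -/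
/-- If `m` commutes with `b` and `c`, and `c` squares to zero, then the two matrices below
multiply to zero. -/
lemma matrix_mul_eq_zero_of_commute_of_sq_eq_zero {R : Type*} [Ring R] {m b c : R}
    (hb : Commute m b) (hc : Commute m c) (hc2 : c ^ 2 = 0) :
    (!![-(b * c), m * b; m * c, -m ^ 2 - b * c] : Matrix (Fin 2) (Fin 2) R) *
      !![m ^ 2 + c * b, m * b; m * c, c * b] = 0 := by
  have hmb (x : R) : b * (m * x) = m * (b * x) := hb.symm.left_comm x
  have hmc (x : R) : c * (m * x) = m * (c * x) := hc.symm.left_comm x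
  have hcc (x : R) : c * (c * x) = 0 := by rw [← mul_assoc, ← sq, hc2, zero_mul]
  rw [sq] at hc2
  ext i j
  fin_cases i <;> fin_cases j <;>
    simp [Matrix.mul_apply, Fin.sum_univ_two, sq, mul_add, sub_mul, mul_assoc, hmb, hmc, hcc, hc2,
      ← hc.eq]

/-- Factorized Cayley–Hamilton identity for the `GL(1|1)`-type Reflection Equation Algebra:
in any associative unital `K`-algebra containing `a, b, c, d` subject to the relations
`q²·ab = ba`, `q²·ca = ac`, `ad = da`, `b² = 0`, `c² = 0`,
`q⁻¹·bc + q·cb = (q − q⁻¹)·a·(a − d)`, `bd − db = (q²−1)·ab`, `cd − dc = −(q²−1)·ca`,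
set `ℓ = q·(a − d)`, `T = q·(a² + bc − cb − d²)`, `S = (2_q)⁻¹·(q⁻¹·ℓ² + T)` and
`A = (2_q)⁻¹·(q·ℓ² − T)` (with `2_q = q + q⁻¹` invertible).  Then the generating matrix
`L = [[a,b],[c,d]]` satisfies `(ℓ·L − q·S·I)·(ℓ·L + q⁻¹·A·I) = 0`, where the scalar
coefficients multiply matrix entries on the left. -/
theorem rea_gl11_factorized_cayley_hamilton {K R : Type*} [Field K] [Ring R] [Algebra K R]
    (q : K) (hq : q ≠ 0) (h2q : q + q⁻¹ ≠ 0) (a b c d : R)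
    (r1 : algebraMap K R (q ^ 2) * (a * b) = b * a)
    (r2 : algebraMap K R (q ^ 2) * (c * a) = a * c)
    (r3 : a * d = d * a)
    (r4 : b ^ 2 = 0)
    (r5 : c ^ 2 = 0)
    (r6 : algebraMap K R q⁻¹ * (b * c) + algebraMap K R q * (c * b)
            = algebraMap K R (q - q⁻¹) * (a * (a - d)))
    (r7 : b * d - d * b = algebraMap K R (q ^ 2 - 1) * (a * b))
    (r8 : c * d - d * c = -(algebraMap K R (q ^ 2 - 1) * (c * a))) :
    ((algebraMap K R q * (a - d)) • (!![a, b; c, d] : Matrix (Fin 2) (Fin 2) R)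
        - (algebraMap K R q *
            (algebraMap K R (q + q⁻¹)⁻¹ *
              (algebraMap K R q⁻¹ * (algebraMap K R q * (a - d)) ^ 2
                + algebraMap K R q * (a ^ 2 + b * c - c * b - d ^ 2)))) •
          (1 : Matrix (Fin 2) (Fin 2) R)) *
      ((algebraMap K R q * (a - d)) • (!![a, b; c, d] : Matrix (Fin 2) (Fin 2) R)
        + (algebraMap K R q⁻¹ *
            (algebraMap K R (q + q⁻¹)⁻¹ *
              (algebraMap K R q * (algebraMap K R q * (a - d)) ^ 2
                - algebraMap K R q * (a ^ 2 + b * c - c * b - d ^ 2)))) •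
          (1 : Matrix (Fin 2) (Fin 2) R)) = 0 := by
  set m := a - d with hm
  simp only [← Algebra.smul_def] at *
  have hmb : Commute m b := by
    change m * b = b * m
    rw [hm, sub_mul, mul_sub, ← r1, eq_add_of_sub_eq r7]
    module
  have hmc : Commute m c := by
    change m * c = c * m
    rw [hm, sub_mul, mul_sub, ← r2, eq_add_of_sub_eq r8]
    module
  have hma : Commute m a := by
    change m * a = a * m
    rw [hm, sub_mul, mul_sub, r3]
  have hcb : c * b = (1 - q⁻¹ ^ 2) • (a * m) - q⁻¹ ^ 2 • (b * c) := by
    have h : c * b = q⁻¹ • (q⁻¹ • (b * c) + q • (c * b)) - q⁻¹ ^ 2 • (b * c) := by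
      match_scalars <;> field_simp
      ring
    rw [h, r6]
    match_scalars <;> field_simp
  have hd : d = a - m := by rw [hm]; abel
  clear_value m
  have hsq : a ^ 2 + b * c - c * b - d ^ 2 =
      (1 + q⁻¹ ^ 2) • (a * m) - m ^ 2 + (1 + q⁻¹ ^ 2) • (b * c) := by
    have hd2 : d ^ 2 = a ^ 2 - (2 : K) • (a * m) + m ^ 2 := by
      rw [hd, sq, sub_mul, mul_sub, mul_sub, hma.eq, sq, sq]
      module
    rw [hd2, hcb]
    module
  have h2 : q ^ 2 + 1 ≠ 0 := by
    intro h
    apply h2q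
    field_simp
    simpa using h
  have hS : (q + q⁻¹)⁻¹ • (q⁻¹ • (q • m) ^ 2 + q • (a ^ 2 + b * c - c * b - d ^ 2)) =
      a * m + b * c := by
    rw [hsq, smul_pow]
    match_scalars <;> field_simp <;> ring
  have hA : (q + q⁻¹)⁻¹ • (q • (q • m) ^ 2 - q • (a ^ 2 + b * c - c * b - d ^ 2)) =
      q ^ 2 • m ^ 2 - a * m - b * c := by
    rw [hsq, smul_pow]
    match_scalars <;> field_simp <;> ring
  rw [hS, hA]
  have hfst : (q • m) • (!![a, b; c, d] : Matrix (Fin 2) (Fin 2) R) -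
      (q • (a * m + b * c)) • (1 : Matrix (Fin 2) (Fin 2) R) =
      q • !![-(b * c), m * b; m * c, -m ^ 2 - b * c] := by
    ext i j
    fin_cases i <;> fin_cases j <;> simp [hd, mul_sub, hma.eq, sq] <;> module
  have hsnd : (q • m) • (!![a, b; c, d] : Matrix (Fin 2) (Fin 2) R) +
      (q⁻¹ • (q ^ 2 • m ^ 2 - a * m - b * c)) • (1 : Matrix (Fin 2) (Fin 2) R) =
      q • !![m ^ 2 + c * b, m * b; m * c, c * b] := by
    ext i j
    fin_cases i <;> fin_cases j <;> simp [hd, hcb, mul_sub, hma.eq, sq] <;>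
      match_scalars <;> field_simp <;> ring
  rw [hfst, hsnd, smul_mul_smul_comm,
    matrix_mul_eq_zero_of_commute_of_sq_eq_zero hmb hmc r5, smul_zero]
end

section
/- Let K be a field of characteristic different from 2 and r ∈ K with r ≠ 0. Let R be an associative unital K-algebra containing elements h, b, c satisfying hb = bh, hc = ch, bc = −cb, b² = 0, and c² = 0. Then h² + bc − r² = ( h − (r − (2r)⁻¹·bc) ) · ( h + (r − (2r)⁻¹·bc) ). -/
/-- The factorization from the super-algebra `Sym(sl(1|1))`: in any associative unital
`K`-algebra (`char K ≠ 2`) containing an element `h` commuting with two elements `b, c`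
which anticommute with each other and square to zero, for any scalar `r ≠ 0` one has
`h² + bc − r² = ( h − (r − (2r)⁻¹·bc) ) · ( h + (r − (2r)⁻¹·bc) )`, exhibiting the defining
polynomial of the super-variety as a product of two degree-one factors. -/
theorem sl11_supervariety_factorization {K A : Type*} [Field K] [Ring A] [Algebra K A]
    (hchar : (2 : K) ≠ 0) (r : K) (hr : r ≠ 0) (h b c : A)
    (r1 : h * b = b * h)
    (r2 : h * c = c * h)
    (r3 : b * c = -(c * b))
    (r4 : b ^ 2 = 0)
    (r5 : c ^ 2 = 0) :
    h ^ 2 + b * c - algebraMap K A (r ^ 2)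
      = (h - (algebraMap K A r - algebraMap K A (2 * r)⁻¹ * (b * c)))
        * (h + (algebraMap K A r - algebraMap K A (2 * r)⁻¹ * (b * c))) := by
  have hbc_sq : b * c * (b * c) = 0 := by
    calc b * c * (b * c) = -(c * b) * (b * c) := by rw [← r3]
      _ = -(c * b ^ 2 * c) := by noncomm_ring
      _ = 0 := by simp [r4]
  have hbc : Commute h (b * c) := Commute.mul_right r1 r2
  have hcomm : Commute h (algebraMap K A r - algebraMap K A (2 * r)⁻¹ * (b * c)) :=
    (Algebra.commute_algebraMap_right r h).sub_right
      ((Algebra.commute_algebraMap_right (2 * r)⁻¹ h).mul_right hbc)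
  have hscal : r * (2 * r)⁻¹ + r * (2 * r)⁻¹ = 1 := by
    field_simp
    norm_num
  have hsq : (algebraMap K A r - algebraMap K A (2 * r)⁻¹ * (b * c))
      * (algebraMap K A r - algebraMap K A (2 * r)⁻¹ * (b * c))
      = algebraMap K A (r ^ 2) - b * c := by
    simp only [← Algebra.smul_def, sub_mul, mul_sub, smul_mul_smul_comm, hbc_sq, smul_zero,
      sub_zero, ← Algebra.commutes r, ← map_mul, smul_smul, pow_two]
    rw [sub_sub, ← add_smul, hscal, one_smul]
  rw [← hcomm.mul_self_sub_mul_self_eq', hsq, pow_two]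
  abel
end
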